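/- arXiv:1804.07366 — 2 statements merged into one kernel-verified Lean document; each statement's English description precedes it below -/
import Mathlib

section
/- Let P be a finite simplicial poset. For any lower order ideal 𝔞 of P, the ideal I_𝔞^P of the dehomogenized face ring S = k[x_p : p ∈ P]/(x_{0̂} − 1) is a radical ideal. -/
open MvPolynomial

attribute [local instance] Classical.propDecidable

/-- Minimal common upper bounds of `p` and `q` inside a lower order ideal `a`. -/
def minUB {P : Type*} [PartialOrder P] (a : Set P) (p q : P) : Set P :=
  {z | z ∈ a ∧ p ≤ z ∧ q ≤ z ∧ ∀ z' ∈ a, p ≤ z' → q ≤ z' → z' ≤ z → z' = z}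

/-- The generators of the face ideal `Ĩ_a^P` of a finite simplicial poset `P`:
the variables `x_p` for `p ∉ a` together with the straightening relations
`x_p x_q − x_{p∧q} ⬝ Σ_{z ∈ u_a(p,q)} x_z` for incomparable `p, q ∈ a`. -/
noncomputable def faceGens (P : Type*) [Fintype P] [PartialOrder P] (kk : Type*) [Field kk]
    (m : P → P → P) (a : Set P) : Set (MvPolynomial P kk) :=
  {f | ∃ p : P, p ∉ a ∧ f = X p} ∪
    {f | ∃ p q : P, p ∈ a ∧ q ∈ a ∧ ¬p ≤ q ∧ ¬q ≤ p ∧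
      f = X p * X q - X (m p q) * ∑ z : P, if z ∈ minUB a p q then X z else 0}

/-- The dehomogenized face ideal `I_a^P` in `S = k[x_p : p ∈ P]/(x_⊥ − 1)`. -/
noncomputable def faceIdeal (P : Type*) [Fintype P] [PartialOrder P] [OrderBot P]
    (kk : Type*) [Field kk] (m : P → P → P) (a : Set P) :
    Ideal (MvPolynomial P kk ⧸ Ideal.span {(X (⊥ : P) : MvPolynomial P kk) - 1}) :=
  Ideal.map (Ideal.Quotient.mk _) (Ideal.span (faceGens P kk m a))

/-- The face ideal, with the dehomogenizing relation, in the polynomial ring. -/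
noncomputable def auxJ (P : Type*) [Fintype P] [PartialOrder P] [OrderBot P]
    (kk : Type*) [Field kk] (m : P → P → P) (a : Set P) : Ideal (MvPolynomial P kk) :=
  Ideal.span (faceGens P kk m a) ⊔ Ideal.span {(X (⊥ : P) : MvPolynomial P kk) - 1}

/-- Restriction to the Boolean interval below `p`. -/
noncomputable def auxPhi {P : Type*} [PartialOrder P]
    (kk : Type*) [Field kk] (p : P) {n : ℕ} (e : Set.Iic p ≃o Finset (Fin n)) :
    MvPolynomial P kk →ₐ[kk] MvPolynomial (Fin n) kk :=
  aeval (fun q => if h : q ≤ p then ∏ i ∈ e ⟨q, h⟩, X i else 0)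

section aux
variable {P : Type*} [Fintype P] [PartialOrder P] [OrderBot P]
    {kk : Type*} [Field kk] {m : P → P → P}

lemma auxPhi_X_le {p : P} {n : ℕ} (e : Set.Iic p ≃o Finset (Fin n)) {q : P} (h : q ≤ p) :
    auxPhi kk p e (X q) = ∏ i ∈ e ⟨q, h⟩, X i := by
  simp [auxPhi, h]

lemma auxPhi_X_not {p : P} {n : ℕ} (e : Set.Iic p ≃o Finset (Fin n)) {q : P} (h : ¬ q ≤ p) :
    auxPhi kk p e (X q) = 0 := by
  simp [auxPhi, h]

/-- Below `p`, the only minimal upper bound is the join. -/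
lemma aux_minUB {a : Set P} (ha : IsLowerSet a) {p : P} (hp : p ∈ a) {n : ℕ}
    (e : Set.Iic p ≃o Finset (Fin n)) {q r : P} (hq : q ≤ p) (hr : r ≤ p) (z : P) (hz : z ≤ p) :
    z ∈ minUB a q r ↔ z = (e.symm (e ⟨q, hq⟩ ∪ e ⟨r, hr⟩) : Set.Iic p).1 := by
  set j : Set.Iic p := e.symm (e ⟨q, hq⟩ ∪ e ⟨r, hr⟩) with hj
  have hqj : q ≤ j.1 := by
    have : (⟨q, hq⟩ : Set.Iic p) ≤ j := by
      rw [hj, OrderIso.le_symm_apply]; exact Finset.subset_union_left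
    exact this
  have hrj : r ≤ j.1 := by
    have : (⟨r, hr⟩ : Set.Iic p) ≤ j := by
      rw [hj, OrderIso.le_symm_apply]; exact Finset.subset_union_right
    exact this
  have hja : j.1 ∈ a := ha j.2 hp
  have key : ∀ w, w ≤ p → q ≤ w → r ≤ w → j.1 ≤ w := by
    intro w hw h1 h2
    have : j ≤ ⟨w, hw⟩ := by
      rw [hj, OrderIso.symm_apply_le]
      exact Finset.union_subset (e.monotone (show (⟨q, hq⟩ : Set.Iic p) ≤ ⟨w, hw⟩ from h1))
        (e.monotone (show (⟨r, hr⟩ : Set.Iic p) ≤ ⟨w, hw⟩ from h2))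
    exact this
  constructor
  · rintro ⟨_, h1, h2, h3⟩
    exact (h3 j.1 hja hqj hrj (key z hz h1 h2)).symm
  · rintro rfl
    exact ⟨hja, hqj, hrj, fun z' _ h1 h2 h3 => le_antisymm h3 (key z' (h3.trans hz) h1 h2)⟩

lemma aux_meet (hm : ∀ p q : P, (∃ z : P, p ≤ z ∧ q ≤ z) →
        IsGreatest {w : P | w ≤ p ∧ w ≤ q} (m p q))
    {p : P} {n : ℕ}
    (e : Set.Iic p ≃o Finset (Fin n)) {q r : P} (hq : q ≤ p) (hr : r ≤ p) :
    ∃ h : m q r ≤ p, e ⟨m q r, h⟩ = e ⟨q, hq⟩ ∩ e ⟨r, hr⟩ := by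
  obtain ⟨⟨h1, h2⟩, h3⟩ := hm q r ⟨p, hq, hr⟩
  refine ⟨h1.trans hq, le_antisymm (Finset.subset_inter ?_ ?_) ?_⟩
  · exact e.monotone (show (⟨m q r, h1.trans hq⟩ : Set.Iic p) ≤ ⟨q, hq⟩ from h1)
  · exact e.monotone (show (⟨m q r, h1.trans hq⟩ : Set.Iic p) ≤ ⟨r, hr⟩ from h2)
  · rw [← OrderIso.symm_apply_le]
    have g1 : e.symm (e ⟨q, hq⟩ ∩ e ⟨r, hr⟩) ≤ ⟨q, hq⟩ := by
      rw [OrderIso.symm_apply_le]; exact Finset.inter_subset_left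
    have g2 : e.symm (e ⟨q, hq⟩ ∩ e ⟨r, hr⟩) ≤ ⟨r, hr⟩ := by
      rw [OrderIso.symm_apply_le]; exact Finset.inter_subset_right
    exact h3 ⟨g1, g2⟩

lemma aux_e_bot {p : P} {n : ℕ} (e : Set.Iic p ≃o Finset (Fin n)) :
    e ⟨⊥, bot_le⟩ = ∅ := by
  have : (⟨⊥, bot_le⟩ : Set.Iic p) ≤ e.symm ∅ := (bot_le : (⊥ : P) ≤ (e.symm ∅ : Set.Iic p).1)
  rw [OrderIso.le_symm_apply] at this
  exact Finset.subset_empty.mp this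

lemma auxPhi_eq_zero (hm : ∀ p q : P, (∃ z : P, p ≤ z ∧ q ≤ z) →
        IsGreatest {w : P | w ≤ p ∧ w ≤ q} (m p q))
    {a : Set P} (ha : IsLowerSet a) {p : P} (hp : p ∈ a) {n : ℕ}
    (e : Set.Iic p ≃o Finset (Fin n)) {f : MvPolynomial P kk} (hf : f ∈ auxJ P kk m a) :
    auxPhi kk p e f = 0 := by
  suffices h : auxJ P kk m a ≤ RingHom.ker (auxPhi kk p e) from h hf
  refine sup_le ?_ ?_
  · rw [Ideal.span_le]
    rintro g (⟨q, hq, rfl⟩ | ⟨q, r, hq, hr, hqr, hrq, rfl⟩)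
    · exact auxPhi_X_not e (fun h => hq (ha h hp))
    · change auxPhi kk p e _ = 0
      rw [map_sub, map_mul, map_mul, map_sum, sub_eq_zero]
      by_cases h : q ≤ p ∧ r ≤ p
      · obtain ⟨h1, h2⟩ := h
        obtain ⟨h3, h4⟩ := aux_meet hm e h1 h2
        set j : Set.Iic p := e.symm (e ⟨q, h1⟩ ∪ e ⟨r, h2⟩) with hj
        rw [Finset.sum_eq_single j.1]
        · rw [if_pos ((aux_minUB ha hp e h1 h2 j.1 j.2).2 rfl), auxPhi_X_le e h1,
            auxPhi_X_le e h2, auxPhi_X_le e h3, auxPhi_X_le e j.2, h4]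
          have : e ⟨j.1, j.2⟩ = e ⟨q, h1⟩ ∪ e ⟨r, h2⟩ := by
            change e j = _
            rw [hj, OrderIso.apply_symm_apply]
          rw [this, mul_comm (∏ i ∈ _ ∩ _, _), Finset.prod_union_inter]
        · intro z _ hz
          split_ifs with hzm
          · refine auxPhi_X_not e (fun hzp => hz ?_)
            exact (aux_minUB ha hp e h1 h2 z hzp).1 hzm
          · simp
        · simp
      · rw [Finset.sum_eq_zero, mul_zero]
        · by_cases h1 : q ≤ p
          · rw [auxPhi_X_not e (fun h2 => h ⟨h1, h2⟩), mul_zero]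
          · rw [auxPhi_X_not e h1, zero_mul]
        · intro z _
          split_ifs with hzm
          · exact auxPhi_X_not e (fun hzp => h ⟨hzm.2.1.trans hzp, hzm.2.2.1.trans hzp⟩)
          · simp
  · rw [Ideal.span_le, Set.singleton_subset_iff]
    change auxPhi kk p e _ = 0
    rw [map_sub, auxPhi_X_le e bot_le, aux_e_bot e]
    simp

lemma aux_mul_mem (hm : ∀ p q : P, (∃ z : P, p ≤ z ∧ q ≤ z) →
        IsGreatest {w : P | w ≤ p ∧ w ≤ q} (m p q))
    {a : Set P} (ha : IsLowerSet a) {p : P} (hp : p ∈ a) (hmax : ∀ z ∈ a, p ≤ z → z = p) {n : ℕ}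
    (e : Set.Iic p ≃o Finset (Fin n)) {h : MvPolynomial P kk} (hh : auxPhi kk p e h = 0) :
    X p * h ∈ auxJ P kk m a := by
  let K : Ideal (MvPolynomial P kk) :=
    Submodule.comap (LinearMap.mulLeft (MvPolynomial P kk) (X p)) (auxJ P kk m a)
  have hK : ∀ g, g ∈ K ↔ X p * g ∈ auxJ P kk m a := fun g => Iff.rfl
  have hJK : ∀ g ∈ auxJ P kk m a, g ∈ K := fun g hg => Ideal.mul_mem_left _ _ hg
  have hgen : ∀ g ∈ faceGens P kk m a, g ∈ auxJ P kk m a :=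
    fun g hg => Ideal.mem_sup_left (Ideal.subset_span hg)
  have hnot : ∀ q, ¬ q ≤ p → X q ∈ K := by
    intro q hq
    by_cases hqa : q ∈ a
    · rw [hK]
      have hpq : ¬ p ≤ q := fun h => hq (hmax q hqa h).le
      have := hgen _ (Or.inr ⟨p, q, hp, hqa, hpq, hq, rfl⟩)
      rw [Finset.sum_eq_zero, mul_zero, sub_zero] at this
      · exact this
      · intro z _
        rw [if_neg]
        rintro ⟨h1, h2, h3, _⟩
        exact hq (hmax z h1 h2 ▸ h3)
    · exact hJK _ (hgen _ (Or.inl ⟨q, hqa, rfl⟩))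
  have hbot : Ideal.Quotient.mk K (X ⊥) = 1 := by
    rw [← map_one (Ideal.Quotient.mk K), Ideal.Quotient.eq]
    exact hJK _ (Ideal.mem_sup_right (Ideal.subset_span rfl))
  have hesymm : (e.symm ∅ : Set.Iic p).1 = ⊥ := by
    rw [← aux_e_bot e, OrderIso.symm_apply_apply]
  have hprod : ∀ s : Finset (Fin n),
      ∏ i ∈ s, Ideal.Quotient.mk K (X (e.symm {i} : Set.Iic p).1) =
        Ideal.Quotient.mk K (X (e.symm s : Set.Iic p).1) := by
    intro s
    induction s using Finset.induction_on with
    | empty => rw [hesymm, hbot, Finset.prod_empty]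
    | insert i s hi ih =>
      rw [Finset.prod_insert hi, ih]
      rcases s.eq_empty_or_nonempty with rfl | hs
      · rw [hesymm, hbot, mul_one]; rfl
      set q : Set.Iic p := e.symm {i} with hq
      set r : Set.Iic p := e.symm s with hr
      have heq : e q = {i} := by rw [hq, OrderIso.apply_symm_apply]
      have her : e r = s := by rw [hr, OrderIso.apply_symm_apply]
      have hqr : ¬ q.1 ≤ r.1 := by
        intro h
        have h' : e q ≤ e r := e.monotone h
        rw [heq, her] at h'
        exact hi (h' (Finset.mem_singleton_self i))
      have hrq : ¬ r.1 ≤ q.1 := by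
        intro h
        have h' : e r ≤ e q := e.monotone h
        rw [heq, her] at h'
        obtain ⟨x, hx⟩ := hs
        have := Finset.mem_singleton.1 (h' hx)
        exact hi (this ▸ hx)
      have hrel := hJK _ (hgen _ (Or.inr ⟨q.1, r.1, ha q.2 hp, ha r.2 hp, hqr, hrq, rfl⟩))
      rw [← Ideal.Quotient.eq, map_mul, map_mul, map_sum] at hrel
      rw [hrel]
      have hmb : m q.1 r.1 = ⊥ := by
        obtain ⟨h3, h4⟩ := aux_meet hm e q.2 r.2
        have h5 : e ⟨m q.1 r.1, h3⟩ = e ⟨⊥, bot_le⟩ := by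
          rw [h4, aux_e_bot e]
          change e q ∩ e r = ∅
          rw [heq, her, Finset.singleton_inter_of_notMem hi]
        exact congrArg Subtype.val (e.injective h5)
      have hjoin : e.symm (e ⟨q.1, q.2⟩ ∪ e ⟨r.1, r.2⟩) = e.symm (insert i s) := by
        change e.symm (e q ∪ e r) = _
        rw [heq, her]; rfl
      rw [hmb, hbot, one_mul, Finset.sum_eq_single (e.symm (insert i s) : Set.Iic p).1]
      · rw [if_pos]
        rw [aux_minUB ha hp e q.2 r.2 _ (e.symm (insert i s)).2, hjoin]
      · intro z _ hz
        split_ifs with hzm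
        · refine Ideal.Quotient.eq_zero_iff_mem.2 (hnot z (fun hzp => hz ?_))
          rw [(aux_minUB ha hp e q.2 r.2 z hzp).1 hzm, hjoin]
        · simp
      · simp
  let psi : MvPolynomial (Fin n) kk →ₐ[kk] (MvPolynomial P kk ⧸ K) :=
    aeval (fun i => Ideal.Quotient.mk K (X (e.symm {i} : Set.Iic p).1))
  have hcomp : psi.comp (auxPhi kk p e) = Ideal.Quotient.mkₐ kk K := by
    apply MvPolynomial.algHom_ext
    intro q
    rw [AlgHom.comp_apply]
    by_cases hq : q ≤ p
    · rw [auxPhi_X_le e hq, map_prod]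
      simp only [psi, aeval_X]
      rw [hprod, OrderIso.symm_apply_apply]
      rfl
    · rw [auxPhi_X_not e hq, map_zero]
      exact (Ideal.Quotient.eq_zero_iff_mem.2 (hnot q hq)).symm
  have := DFunLike.congr_fun hcomp h
  rw [AlgHom.comp_apply, hh, map_zero] at this
  exact (hK h).1 (Ideal.Quotient.eq_zero_iff_mem.1 this.symm)

lemma aux_le {a : Set P} {p : P} (hp : p ∈ a) (hmax : ∀ z ∈ a, p ≤ z → z = p) :
    auxJ P kk m (a \ {p}) ≤ auxJ P kk m a ⊔ Ideal.span {X p} := by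
  have hgen : ∀ g ∈ faceGens P kk m a, g ∈ auxJ P kk m a :=
    fun g hg => Ideal.mem_sup_left (Ideal.subset_span hg)
  have hXp : (X p : MvPolynomial P kk) ∈ auxJ P kk m a ⊔ Ideal.span {X p} :=
    Ideal.mem_sup_right (Ideal.subset_span rfl)
  refine sup_le ?_ (le_trans le_sup_right le_sup_left)
  rw [Ideal.span_le]
  rintro g (⟨q, hq, rfl⟩ | ⟨q, r, hq, hr, hqr, hrq, rfl⟩)
  · by_cases h : q = p
    · subst h; exact hXp
    · exact Ideal.mem_sup_left (hgen _ (Or.inl ⟨q, fun h' => hq ⟨h', h⟩, rfl⟩))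
  · have h1 := Ideal.mem_sup_left (S := auxJ P kk m a) (T := Ideal.span {X p})
      (hgen _ (Or.inr ⟨q, r, hq.1, hr.1, hqr, hrq, rfl⟩))
    have h2 : (X (m q r) * if p ∈ minUB a q r then X p else 0 : MvPolynomial P kk) ∈
        auxJ P kk m a ⊔ Ideal.span {X p} := by
      split_ifs
      · exact Ideal.mul_mem_left _ _ hXp
      · simp
    have h3 := Ideal.add_mem _ h1 h2
    have hs : ∀ z, z ∈ minUB (a \ {p}) q r ↔ z ∈ minUB a q r ∧ z ≠ p := by
      intro z
      constructor
      · rintro ⟨⟨hz, hzp⟩, g1, g2, g3⟩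
        refine ⟨⟨hz, g1, g2, fun z' hz' k1 k2 k3 => g3 z' ⟨hz', ?_⟩ k1 k2 k3⟩, hzp⟩
        rintro rfl
        exact hzp (hmax z hz k3)
      · rintro ⟨⟨hz, g1, g2, g3⟩, hzp⟩
        exact ⟨⟨hz, hzp⟩, g1, g2, fun z' hz' => g3 z' hz'.1⟩
    have hsum : (∑ z : P, if z ∈ minUB a q r then X z else 0 : MvPolynomial P kk) =
        (∑ z : P, if z ∈ minUB (a \ {p}) q r then X z else 0) +
          if p ∈ minUB a q r then X p else 0 := by
      rw [← Finset.sum_erase_add _ _ (Finset.mem_univ p),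
        ← Finset.sum_erase_add (a := p) Finset.univ
          (fun z => if z ∈ minUB (a \ {p}) q r then (X z : MvPolynomial P kk) else 0)
          (Finset.mem_univ p)]
      have : p ∉ minUB (a \ {p}) q r := fun h => ((hs p).1 h).2 rfl
      rw [if_neg this, add_zero]
      congr 1
      refine Finset.sum_congr rfl (fun z hz => ?_)
      have hz' : z ≠ p := (Finset.mem_erase.1 hz).1
      simp [hs z, hz']
    rw [hsum] at h3
    rw [SetLike.mem_coe]
    convert h3 using 1
    ring

lemma aux_main (hsimp : ∀ p : P, ∃ n : ℕ, Nonempty (Set.Iic p ≃o Finset (Fin n)))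
    (hm : ∀ p q : P, (∃ z : P, p ≤ z ∧ q ≤ z) →
        IsGreatest {w : P | w ≤ p ∧ w ≤ q} (m p q)) (f : MvPolynomial P kk) :
    ∀ (N : ℕ) (a : Set P), a.ncard = N → IsLowerSet a →
      (∀ p ∈ a, ∀ (n : ℕ) (e : Set.Iic p ≃o Finset (Fin n)), auxPhi kk p e f = 0) →
      f ∈ auxJ P kk m a := by
  intro N
  induction N with
  | zero =>
    intro a hN ha _
    have : a = ∅ := (Set.ncard_eq_zero (Set.toFinite a)).1 hN
    subst this
    have h1 : (X ⊥ : MvPolynomial P kk) ∈ auxJ P kk m ∅ :=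
      Ideal.mem_sup_left (Ideal.subset_span (Or.inl ⟨⊥, fun h => h, rfl⟩))
    have h2 : (X ⊥ - 1 : MvPolynomial P kk) ∈ auxJ P kk m ∅ :=
      Ideal.mem_sup_right (Ideal.subset_span rfl)
    have h3 := Ideal.sub_mem _ h1 h2
    rw [sub_sub_cancel] at h3
    rw [(Ideal.eq_top_iff_one _).2 h3]
    trivial
  | succ N ih =>
    intro a hN ha hf
    have hne : a.Nonempty := by
      rw [← Set.ncard_pos (Set.toFinite a)]; omega
    obtain ⟨p, hpm⟩ := (Set.toFinite a).exists_maximal hne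
    have hp : p ∈ a := hpm.1
    have hmax : ∀ z ∈ a, p ≤ z → z = p := fun z hz h => le_antisymm (hpm.2 hz h) h
    have ha' : IsLowerSet (a \ {p}) := by
      rintro x y hyx ⟨hx, hxp⟩
      refine ⟨ha hyx hx, ?_⟩
      rintro rfl
      exact hxp (hmax x hx hyx)
    have h1 := ih (a \ {p}) (by rw [Set.ncard_sdiff_singleton_of_mem hp]; omega) ha'
      (fun q hq => hf q hq.1)
    obtain ⟨g, hg, y, hy, rfl⟩ := Submodule.mem_sup.1 (aux_le hp hmax h1)
    obtain ⟨h, rfl⟩ := Ideal.mem_span_singleton'.1 hy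
    obtain ⟨n, ⟨e⟩⟩ := hsimp p
    have h2 := hf p hp n e
    rw [map_add, auxPhi_eq_zero hm ha hp e hg, zero_add, map_mul, auxPhi_X_le e le_rfl] at h2
    have h3 : auxPhi kk p e h = 0 := by
      rcases mul_eq_zero.1 h2 with h3 | h3
      · exact h3
      · rw [Finset.prod_eq_zero_iff] at h3
        obtain ⟨i, _, hi⟩ := h3
        exact absurd hi (X_ne_zero i)
    refine Ideal.add_mem _ hg ?_
    rw [mul_comm]
    exact aux_mul_mem hm ha hp hmax e h3

end aux

/-- Let `P` be a finite simplicial poset (every lower interval is a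
Boolean algebra) with meet operation `m` defined on pairs with a common upper bound.
For every lower order ideal `a ⊆ P`, the ideal `I_a^P` of the dehomogenized face ring is
a radical ideal. -/
theorem faceIdeal_isRadical
    {P : Type*} [Fintype P] [PartialOrder P] [OrderBot P]
    (kk : Type*) [Field kk]
    (hsimp : ∀ p : P, ∃ n : ℕ, Nonempty (Set.Iic p ≃o Finset (Fin n)))
    (m : P → P → P)
    (hm : ∀ p q : P, (∃ z : P, p ≤ z ∧ q ≤ z) →
        IsGreatest {w : P | w ≤ p ∧ w ≤ q} (m p q))
    (a : Set P) (ha : IsLowerSet a) :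
    (faceIdeal P kk m a).IsRadical := by
  have hcm : ∀ g : MvPolynomial P kk,
      Ideal.Quotient.mk _ g ∈ faceIdeal P kk m a ↔ g ∈ auxJ P kk m a := by
    intro g
    rw [← Ideal.mem_comap, faceIdeal,
      Ideal.comap_map_of_surjective' _ Ideal.Quotient.mk_surjective, Ideal.mk_ker, auxJ]
  rintro f ⟨k, hk⟩
  obtain ⟨g, rfl⟩ := Ideal.Quotient.mk_surjective f
  rw [← map_pow, hcm] at hk
  rw [hcm]
  refine aux_main hsimp hm g _ a rfl ha (fun p hp n e => ?_)
  have := auxPhi_eq_zero hm ha hp e hk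
  rw [map_pow] at this
  exact eq_zero_of_pow_eq_zero this
end

section
/- Let P be a finite simplicial poset. Then the face ideal I_P^P equals the intersection of the prime ideals I_{(σ)}^P over all maximal elements σ of P, where (σ) denotes the principal lower order ideal generated by σ. In particular, Stanley's face ring of P is isomorphic to the ring of global sections of the Yuzvinsky sheaf: A_P = S/I_P^P ≅ S/⋂_{σ maximal} I_{(σ)}^P. -/
open MvPolynomial

attribute [local instance] Classical.propDecidable

set_option linter.unusedSectionVars false

namespace FaceAux

variable {P : Type*} [Fintype P] [PartialOrder P] [OrderBot P] (kk : Type*) [Field kk]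

/-- exponent vector of a finset -/
noncomputable def ind {n : ℕ} (s : Finset (Fin n)) : Fin n →₀ ℕ :=
  Finsupp.equivFunOnFinite.symm (fun i => if i ∈ s then 1 else 0)

theorem ind_apply {n : ℕ} (s : Finset (Fin n)) (i : Fin n) :
    ind s i = if i ∈ s then 1 else 0 := rfl

theorem ind_union_inter {n : ℕ} (s t : Finset (Fin n)) :
    ind s + ind t = ind (s ∩ t) + ind (s ∪ t) := by
  ext i
  simp only [Finsupp.add_apply, ind_apply, Finset.mem_inter, Finset.mem_union]
  by_cases h1 : i ∈ s <;> by_cases h2 : i ∈ t <;> simp [h1, h2]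

/-- the evaluation at a face -/
noncomputable def phi {n : ℕ} (σ : P) (e : P → Finset (Fin n)) :
    MvPolynomial P kk →ₐ[kk] MvPolynomial (Fin n) kk :=
  aeval (fun p => if p ≤ σ then monomial (ind (e p)) 1 else 0)

/-- `e` is a coordinatization of `Iic σ` -/
structure Coord {n : ℕ} (σ : P) (e : P → Finset (Fin n)) : Prop where
  le_iff : ∀ p q, p ≤ σ → q ≤ σ → (e p ⊆ e q ↔ p ≤ q)
  surj : ∀ s, ∃ p, p ≤ σ ∧ e p = s

theorem exists_coord (σ : P) (n : ℕ) (g : Set.Iic σ ≃o Finset (Fin n)) :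
    ∃ e : P → Finset (Fin n), Coord σ e := by
  refine ⟨fun p => if h : p ≤ σ then g ⟨p, h⟩ else ∅, ?_, ?_⟩
  · intro p q hp hq
    simp only [hp, hq, dif_pos]
    exact g.le_iff_le (x := ⟨p, hp⟩) (y := ⟨q, hq⟩)
  · intro s
    refine ⟨(g.symm s).1, (g.symm s).2, ?_⟩
    have h : (g.symm s).1 ≤ σ := (g.symm s).2
    simp only [h, dif_pos]
    exact g.apply_symm_apply s

theorem Coord.inj {n : ℕ} {σ : P} {e : P → Finset (Fin n)} (h : Coord σ e) {p q : P}
    (hp : p ≤ σ) (hq : q ≤ σ) (hpq : e p = e q) : p = q :=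
  le_antisymm ((h.le_iff p q hp hq).1 hpq.le) ((h.le_iff q p hq hp).1 hpq.ge)

theorem Coord.bot {n : ℕ} {σ : P} {e : P → Finset (Fin n)} (h : Coord σ e) : e ⊥ = ∅ := by
  obtain ⟨p, hp, hpe⟩ := h.surj ∅
  have := (h.le_iff ⊥ p bot_le hp).2 bot_le
  rw [hpe] at this
  exact Finset.subset_empty.1 this

theorem Coord.meet {n : ℕ} {σ : P} {e : P → Finset (Fin n)} (h : Coord σ e) {p q w : P}
    (hp : p ≤ σ) (hq : q ≤ σ) (hw : IsGreatest {w : P | w ≤ p ∧ w ≤ q} w) :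
    e w = e p ∩ e q := by
  have hwσ : w ≤ σ := hw.1.1.trans hp
  obtain ⟨v, hv, hve⟩ := h.surj (e p ∩ e q)
  apply le_antisymm
  · exact Finset.subset_inter ((h.le_iff _ _ hwσ hp).2 hw.1.1) ((h.le_iff _ _ hwσ hq).2 hw.1.2)
  · rw [← hve]
    refine (h.le_iff _ _ hv hwσ).2 (hw.2 ⟨?_, ?_⟩)
    · exact (h.le_iff _ _ hv hp).1 (hve ▸ Finset.inter_subset_left)
    · exact (h.le_iff _ _ hv hq).1 (hve ▸ Finset.inter_subset_right)

/-- full (non-quotient) ideal -/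
noncomputable def J (m : P → P → P) (a : Set P) : Ideal (MvPolynomial P kk) :=
  Ideal.span (faceGens P kk m a) ⊔ Ideal.span {(X (⊥ : P) : MvPolynomial P kk) - 1}

theorem phi_X {n : ℕ} (σ : P) (e : P → Finset (Fin n)) (p : P) :
    phi kk σ e (X p) = if p ≤ σ then monomial (ind (e p)) 1 else 0 := by
  simp [phi]

theorem J_le_ker {n : ℕ} {σ : P} {e : P → Finset (Fin n)} (h : Coord σ e)
    (m : P → P → P)
    (hm : ∀ p q : P, (∃ z : P, p ≤ z ∧ q ≤ z) →
        IsGreatest {w : P | w ≤ p ∧ w ≤ q} (m p q))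
    (a : Set P) (ha : IsLowerSet a) (hσ : σ ∈ a) :
    J kk m a ≤ RingHom.ker (phi kk σ e) := by
  refine sup_le (Ideal.span_le.2 ?_) (Ideal.span_le.2 ?_)
  · rintro f (⟨p, hp, rfl⟩ | ⟨p, q, hp, hq, hpq, hqp, rfl⟩)
    · have : ¬ p ≤ σ := fun hh => hp (ha hh hσ)
      simp [RingHom.mem_ker, phi_X, this]
    · simp only [SetLike.mem_coe, RingHom.mem_ker, map_sub, map_mul, map_sum]
      by_cases hps : p ≤ σ ∧ q ≤ σ
      · obtain ⟨hps, hqs⟩ := hps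
        obtain ⟨z, hz, hze⟩ := h.surj (e p ∪ e q)
        have hpz : p ≤ z := (h.le_iff _ _ hps hz).1 (hze ▸ Finset.subset_union_left)
        have hqz : q ≤ z := (h.le_iff _ _ hqs hz).1 (hze ▸ Finset.subset_union_right)
        have hleast : ∀ y, y ≤ σ → p ≤ y → q ≤ y → z ≤ y := by
          intro y hy h1 h2
          refine (h.le_iff _ _ hz hy).1 ?_
          rw [hze]
          exact Finset.union_subset ((h.le_iff _ _ hps hy).2 h1) ((h.le_iff _ _ hqs hy).2 h2)
        have hzU : z ∈ minUB a p q :=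
          ⟨ha hz hσ, hpz, hqz, fun z' _ h1 h2 h3 =>
            le_antisymm h3 (hleast z' (h3.trans hz) h1 h2)⟩
        have hg := hm p q ⟨z, hpz, hqz⟩
        have hms : m p q ≤ σ := hg.1.1.trans hps
        rw [Finset.sum_eq_single z]
        · simp only [phi_X, hps, hqs, hms, hz, hzU, if_true, monomial_mul, mul_one, h.meet hps hqs hg,
            hze]
          rw [ind_union_inter, sub_self]
        · intro y _ hyz
          by_cases hyU : y ∈ minUB a p q
          · have : ¬ y ≤ σ := fun hy =>
              hyz (hyU.2.2.2 z hzU.1 hpz hqz (hleast y hy hyU.2.1 hyU.2.2.1)).symm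
            simp [hyU, phi_X, this]
          · simp [hyU]
        · simp
      · have h1 : phi kk σ e (X p) * phi kk σ e (X q) = 0 := by
          rw [phi_X, phi_X]
          rcases not_and_or.1 hps with h | h <;> simp [h]
        rw [h1, Finset.sum_eq_zero]
        · simp
        · intro y _
          by_cases hyU : y ∈ minUB a p q
          · have : ¬ y ≤ σ := fun hy =>
              hps ⟨hyU.2.1.trans hy, hyU.2.2.1.trans hy⟩
            simp [hyU, phi_X, this]
          · simp [hyU]
  · rintro f rfl
    have : ind (e ⊥) = 0 := by
      ext i; simp [ind_apply, h.bot]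
    simp [RingHom.mem_ker, phi_X, this]

/-- standard monomials -/
structure Std (a : Set P) (d : P →₀ ℕ) : Prop where
  sub : ∀ p ∈ d.support, p ∈ a
  chain : ∀ p ∈ d.support, ∀ q ∈ d.support, p ≤ q ∨ q ≤ p
  bot : ⊥ ∉ d.support

theorem Std.exists_top {a : Set P} {d : P →₀ ℕ} (h : Std a d) (hd : d ≠ 0) :
    ∃ t ∈ d.support, ∀ p ∈ d.support, p ≤ t := by
  obtain ⟨t, ht⟩ := d.support.exists_maximal (Finsupp.support_nonempty_iff.2 hd)
  refine ⟨t, ht.1, fun p hp => ?_⟩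
  rcases h.chain p hp t ht.1 with h1 | h1
  · exact h1
  · exact ht.2 hp h1

/-- exponent of the image of a monomial -/
noncomputable def expo {n : ℕ} (e : P → Finset (Fin n)) (d : P →₀ ℕ) : Fin n →₀ ℕ :=
  d.sum (fun p k => k • ind (e p))

theorem expo_add {n : ℕ} (e : P → Finset (Fin n)) (d d' : P →₀ ℕ) :
    expo e (d + d') = expo e d + expo e d' := by
  unfold expo
  rw [Finsupp.sum_add_index'] <;> simp [add_smul]

theorem expo_single {n : ℕ} (e : P → Finset (Fin n)) (p : P) :
    expo e (Finsupp.single p 1) = ind (e p) := by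
  simp [expo]

theorem expo_apply_ne {n : ℕ} (e : P → Finset (Fin n)) (d : P →₀ ℕ) (i : Fin n) :
    expo e d i ≠ 0 ↔ ∃ p ∈ d.support, i ∈ e p := by
  simp only [expo, Finsupp.sum, ind_apply, Finsupp.finsetSum_apply, Finsupp.smul_apply, ne_eq,
    Finset.sum_eq_zero_iff]
  push Not
  refine exists_congr fun p => and_congr_right fun hp => ?_
  have := Finsupp.mem_support_iff.1 hp
  simp [this]

theorem expo_top {n : ℕ} {σ : P} {e : P → Finset (Fin n)} (h : Coord σ e)
    (d : P →₀ ℕ) (hd : ∀ p ∈ d.support, p ≤ σ) (t : P) (ht : t ∈ d.support)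
    (ht' : ∀ p ∈ d.support, p ≤ t) : e t = (expo e d).support := by
  ext i
  rw [Finsupp.mem_support_iff, expo_apply_ne]
  constructor
  · exact fun hi => ⟨t, ht, hi⟩
  · rintro ⟨p, hp, hi⟩
    exact (h.le_iff p t (hd p hp) (hd t ht)).2 (ht' p hp) hi

theorem Std.of_add {a : Set P} {d d' : P →₀ ℕ} (h : Std a (d + d')) : Std a d := by
  have : ∀ p ∈ d.support, p ∈ (d + d').support := by
    intro p hp
    simp only [Finsupp.mem_support_iff, Finsupp.add_apply] at *
    omega
  exact ⟨fun p hp => h.sub p (this p hp), fun p hp q hq => h.chain p (this p hp) q (this q hq),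
    fun hb => h.bot (this _ hb)⟩

theorem exists_sub (d : P →₀ ℕ) (t : P) (ht : t ∈ d.support) :
    ∃ d', d = d' + Finsupp.single t 1 := by
  refine ⟨d - Finsupp.single t 1, ?_⟩
  rw [tsub_add_cancel_of_le]
  rw [Finsupp.single_le_iff]
  have := Finsupp.mem_support_iff.1 ht
  omega

theorem Std.expo_ne {n : ℕ} {σ : P} {e : P → Finset (Fin n)} (h : Coord σ e) {a : Set P}
    {d : P →₀ ℕ} (hd : Std a d) (hσ : ∀ p ∈ d.support, p ≤ σ) (h0 : d ≠ 0) : expo e d ≠ 0 := by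
  obtain ⟨t, ht, ht'⟩ := hd.exists_top h0
  intro hz
  have h1 := expo_top h d hσ t ht ht'
  rw [hz, Finsupp.support_zero, ← h.bot] at h1
  have := h.inj (hσ t ht) bot_le h1
  exact hd.bot (this ▸ ht)

theorem expo_inj {n : ℕ} {σ : P} {e : P → Finset (Fin n)} (h : Coord σ e) {a : Set P} (N : ℕ) :
    ∀ {d d' : P →₀ ℕ} (_ : d.degree = N) (_ : Std a d) (_ : Std a d')
    (_ : ∀ p ∈ d.support, p ≤ σ) (_ : ∀ p ∈ d'.support, p ≤ σ)
    (_ : expo e d = expo e d'), d = d' := by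
  induction N with
  | zero =>
    intro d d' hN hd hd' hs hs' he
    have h0 : d = 0 := (Finsupp.degree_eq_zero_iff d).1 hN
    by_contra hne
    have : d' ≠ 0 := by rintro rfl; exact hne h0
    apply hd'.expo_ne h hs' this
    rw [← he, h0]; simp [expo]
  | succ N ih =>
    intro d d' hN hd hd' hs hs' he
    have h0 : d ≠ 0 := by rintro rfl; simp at hN
    have h0' : d' ≠ 0 := by
      rintro rfl
      apply hd.expo_ne h hs h0
      rw [he]; simp [expo]
    obtain ⟨t, ht, htop⟩ := hd.exists_top h0
    obtain ⟨t', ht', htop'⟩ := hd'.exists_top h0'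
    have h1 := expo_top h d hs t ht htop
    have h1' := expo_top h d' hs' t' ht' htop'
    rw [he, ← h1'] at h1
    obtain rfl := h.inj (hs t ht) (hs' t' ht') h1
    obtain ⟨c, rfl⟩ := exists_sub d t ht
    obtain ⟨c', rfl⟩ := exists_sub d' t ht'
    have hsub : ∀ (c : P →₀ ℕ), ∀ p ∈ c.support, p ∈ (c + Finsupp.single t 1).support := by
      intro c p hp
      simp only [Finsupp.mem_support_iff, Finsupp.add_apply] at *
      omega
    congr 1
    apply ih
    · simpa using hN
    · exact hd.of_add
    · exact hd'.of_add
    · exact fun p hp => hs p (hsub c p hp)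
    · exact fun p hp => hs' p (hsub c' p hp)
    · simpa [expo_add] using he

theorem phi_monomial {n : ℕ} (σ : P) (e : P → Finset (Fin n)) (d : P →₀ ℕ) (c : kk) :
    phi kk σ e (monomial d c) =
      if ∀ p ∈ d.support, p ≤ σ then monomial (expo e d) c else 0 := by
  rw [phi, aeval_monomial]
  split_ifs with h
  · have : d.prod (fun i k => (if i ≤ σ then monomial (ind (e i)) (1 : kk) else 0) ^ k)
        = monomial (expo e d) 1 := by
      rw [expo, Finsupp.sum, Finsupp.prod, monomial_sum_one]
      refine Finset.prod_congr rfl fun p hp => ?_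
      rw [if_pos (h p hp), monomial_pow, one_pow]
    rw [this]
    simp [algebraMap_eq, C_mul_monomial]
  · push Not at h
    obtain ⟨p, hp, hps⟩ := h
    rw [Finsupp.prod, Finset.prod_eq_zero hp, mul_zero]
    simp [hps, Finsupp.mem_support_iff.1 hp]

/-- the spanned submodule -/
noncomputable def T (m : P → P → P) (a : Set P) : Submodule kk (MvPolynomial P kk) :=
  (J kk m a).restrictScalars kk ⊔ Submodule.span kk {f | ∃ d, Std a d ∧ f = monomial d 1}

theorem J_le_T (m : P → P → P) (a : Set P) {f : MvPolynomial P kk} (hf : f ∈ J kk m a) :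
    f ∈ T kk m a := Submodule.mem_sup_left hf

/-- weight -/
noncomputable def wt (p : P) : ℕ := 2 ^ (Finset.univ.filter (· ≤ p)).card

theorem wt_le (p : P) : wt p ≤ 2 ^ Fintype.card P :=
  Nat.pow_le_pow_right (by norm_num) (Finset.card_le_univ _)

theorem wt_lt {p q : P} (h : p < q) : 2 * wt p ≤ wt q := by
  unfold wt
  rw [← pow_succ']
  apply Nat.pow_le_pow_right (by norm_num)
  apply Nat.succ_le_of_lt
  apply Finset.card_lt_card
  rw [Finset.ssubset_iff_of_subset]
  · exact ⟨q, by simp, by simpa using h.not_ge⟩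
  · intro x hx
    simp only [Finset.mem_filter, Finset.mem_univ, true_and] at *
    exact hx.trans h.le

/-- weight of a monomial -/
noncomputable def wtm (d : P →₀ ℕ) : ℕ := d.sum (fun p k => k * wt p)

theorem wtm_add (d d' : P →₀ ℕ) : wtm (d + d') = wtm d + wtm d' := by
  unfold wtm
  rw [Finsupp.sum_add_index'] <;> simp [add_mul]

theorem wtm_single (p : P) : wtm (Finsupp.single p 1) = wt p := by
  simp [wtm]

theorem wtm_le (d : P →₀ ℕ) : wtm d ≤ d.degree * 2 ^ Fintype.card P := by
  rw [wtm, Finsupp.sum, Finsupp.degree_apply, Finset.sum_mul]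
  exact Finset.sum_le_sum fun p _ => Nat.mul_le_mul_left _ (wt_le p)

theorem strip (m : P → P → P) (a : Set P) (d : P →₀ ℕ) :
    monomial d (1 : kk) - monomial (d.erase ⊥) 1 ∈ J kk m a := by
  have h1 : monomial d (1 : kk) = X ⊥ ^ (d ⊥) * monomial (d.erase ⊥) 1 := by
    rw [X_pow_eq_monomial, monomial_mul, mul_one, Finsupp.single_add_erase]
  have h2 : (X ⊥ : MvPolynomial P kk) ^ (d ⊥) - 1 ∈ J kk m a := by
    apply Ideal.mem_sup_right
    rw [Ideal.mem_span_singleton]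
    exact sub_one_dvd_pow_sub_one _ _
  have : monomial d (1 : kk) - monomial (d.erase ⊥) 1
      = monomial (d.erase ⊥) 1 * ((X ⊥ : MvPolynomial P kk) ^ (d ⊥) - 1) := by
    rw [h1]; ring
  rw [this]
  exact Ideal.mul_mem_left _ _ h2

theorem monomial_mem_T (m : P → P → P)
    (hm : ∀ p q : P, (∃ z : P, p ≤ z ∧ q ≤ z) →
        IsGreatest {w : P | w ≤ p ∧ w ≤ q} (m p q))
    (a : Set P) (N : ℕ) : ∀ d : P →₀ ℕ, d.degree * 2 ^ Fintype.card P - wtm d = N →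
      monomial d (1 : kk) ∈ T kk m a := by
  induction N using Nat.strong_induction_on with
  | _ N ih =>
  intro d hN
  by_cases hsub : ∀ p ∈ d.support, p ∈ a
  swap
  · push Not at hsub
    obtain ⟨p, hp, hpa⟩ := hsub
    obtain ⟨c, rfl⟩ := exists_sub d p hp
    apply J_le_T
    have : monomial (c + Finsupp.single p 1) (1 : kk) = monomial c 1 * X p := by
      rw [X, monomial_mul, mul_one]
    rw [this]
    exact Ideal.mul_mem_left _ _ (Ideal.mem_sup_left (Ideal.subset_span (Or.inl ⟨p, hpa, rfl⟩)))
  by_cases hch : ∀ p ∈ d.support, ∀ q ∈ d.support, p ≤ q ∨ q ≤ p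
  · rw [← sub_add_cancel (monomial d (1 : kk)) (monomial (d.erase ⊥) 1)]
    refine Submodule.add_mem _ (J_le_T kk m a (strip kk m a d)) ?_
    apply Submodule.mem_sup_right
    apply Submodule.subset_span
    refine ⟨_, ⟨?_, ?_, ?_⟩, rfl⟩
    · exact fun p hp => hsub p (by rw [Finsupp.support_erase] at hp; exact Finset.mem_of_mem_erase hp)
    · intro p hp q hq
      rw [Finsupp.support_erase] at hp hq
      exact hch p (Finset.mem_of_mem_erase hp) q (Finset.mem_of_mem_erase hq)
    · simp
  · push Not at hch
    obtain ⟨p, hp, q, hq, hpq, hqp⟩ := hch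
    have hpa := hsub p hp
    have hqa := hsub q hq
    obtain ⟨c, rfl⟩ := exists_sub d p hp
    have hne : q ≠ p := by rintro rfl; exact hpq le_rfl
    have hqc : q ∈ c.support := by
      simpa [Finsupp.single_apply, hne.symm] using hq
    obtain ⟨b, rfl⟩ := exists_sub c q hqc
    have key : monomial (b + Finsupp.single q 1 + Finsupp.single p 1) (1 : kk)
        = monomial b 1 * (X p * X q - X (m p q) * ∑ z : P, if z ∈ minUB a p q then X z else 0)
          + ∑ z : P, if z ∈ minUB a p q then
            monomial (b + Finsupp.single (m p q) 1 + Finsupp.single z 1) (1 : kk) else 0 := by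
      have h1 : ∀ x y : P, monomial (b + Finsupp.single x 1 + Finsupp.single y 1) (1 : kk)
          = monomial b 1 * X x * X y := by
        intro x y
        simp [X, monomial_mul]
      simp only [h1]
      have h2 : (∑ z : P, if z ∈ minUB a p q then
            monomial b (1 : kk) * X (m p q) * X z else 0) = monomial b 1 * X (m p q) *
            ∑ z : P, if z ∈ minUB a p q then X z else 0 := by
        rw [Finset.mul_sum]
        exact Finset.sum_congr rfl fun z _ => by split_ifs <;> simp
      rw [h2]
      ring
    rw [key]
    refine Submodule.add_mem _ (J_le_T kk m a ?_) (Submodule.sum_mem _ fun z _ => ?_)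
    · exact Ideal.mul_mem_left _ _ (Ideal.mem_sup_left (Ideal.subset_span
        (Or.inr ⟨p, q, hpa, hqa, hpq, hqp, rfl⟩)))
    · split_ifs with hz
      · refine ih _ ?_ _ rfl
        have hpz : p < z := lt_of_le_of_ne hz.2.1 (by rintro rfl; exact hqp hz.2.2.1)
        have hqz : q < z := lt_of_le_of_ne hz.2.2.1 (by rintro rfl; exact hpq hz.2.1)
        have e1 := wt_lt hpz
        have e2 := wt_lt hqz
        have e3 : 0 < wt (m p q) := by unfold wt; positivity
        have e4 := wtm_le (b + Finsupp.single (m p q) 1 + Finsupp.single z 1)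
        rw [← hN]
        simp only [wtm_add, wtm_single, map_add, Finsupp.degree_single] at e4 ⊢
        omega
      · exact Submodule.zero_mem _

theorem mem_T (m : P → P → P)
    (hm : ∀ p q : P, (∃ z : P, p ≤ z ∧ q ≤ z) →
        IsGreatest {w : P | w ≤ p ∧ w ≤ q} (m p q))
    (a : Set P) (f : MvPolynomial P kk) : f ∈ T kk m a := by
  rw [f.as_sum]
  refine Submodule.sum_mem _ fun d _ => ?_
  have : monomial d (coeff d f) = coeff d f • monomial d (1 : kk) := by
    rw [smul_monomial, smul_eq_mul, mul_one]
  rw [this]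
  exact Submodule.smul_mem _ _ (monomial_mem_T kk m hm a _ d rfl)

theorem exists_std (m : P → P → P)
    (hm : ∀ p q : P, (∃ z : P, p ≤ z ∧ q ≤ z) →
        IsGreatest {w : P | w ≤ p ∧ w ≤ q} (m p q))
    (a : Set P) (f : MvPolynomial P kk) :
    ∃ j ∈ J kk m a, ∃ s : MvPolynomial P kk, (∀ d ∈ s.support, Std a d) ∧ j + s = f := by
  obtain ⟨j, hj, s, hs, h⟩ := Submodule.mem_sup.1 (mem_T kk m hm a f)
  refine ⟨j, hj, s, ?_, h⟩
  clear h
  induction hs using Submodule.span_induction with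
  | mem x hx =>
    obtain ⟨d, hd, rfl⟩ := hx
    intro d' hd'
    rw [Finset.mem_singleton.1 (support_monomial_subset hd')]
    exact hd
  | zero => simp
  | add x y _ _ hx hy =>
    intro d hd
    rcases Finset.mem_union.1 (support_add hd) with h | h
    · exact hx d h
    · exact hy d h
  | smul c x _ hx =>
    exact fun d hd => hx d (support_smul hd)

theorem mem_J_iff {n : P → ℕ} (e : ∀ σ : P, P → Finset (Fin (n σ))) (he : ∀ σ, Coord σ (e σ))
    (m : P → P → P)
    (hm : ∀ p q : P, (∃ z : P, p ≤ z ∧ q ≤ z) →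
        IsGreatest {w : P | w ≤ p ∧ w ≤ q} (m p q))
    (a : Set P) (ha : IsLowerSet a) (hbot : ⊥ ∈ a) (M : Set P) (hM : M ⊆ a)
    (hcof : ∀ p ∈ a, ∃ σ ∈ M, p ≤ σ) (f : MvPolynomial P kk) :
    f ∈ J kk m a ↔ ∀ σ ∈ M, phi kk σ (e σ) f = 0 := by
  refine ⟨fun hf σ hσ => J_le_ker kk (he σ) m hm a ha (hM hσ) hf, fun hf => ?_⟩
  obtain ⟨j, hj, s, hs, rfl⟩ := exists_std kk m hm a f
  have hs0 : ∀ σ ∈ M, phi kk σ (e σ) s = 0 := by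
    intro σ hσ
    have h1 := hf σ hσ
    have h2 : phi kk σ (e σ) j = 0 := J_le_ker kk (he σ) m hm a ha (hM hσ) hj
    rwa [map_add, h2, zero_add] at h1
  suffices s = 0 by simpa [this] using hj
  rw [← support_eq_empty, Finset.eq_empty_iff_forall_notMem]
  intro d hd
  have hstd := hs d hd
  obtain ⟨σ, hσ, hdσ⟩ : ∃ σ ∈ M, ∀ p ∈ d.support, p ≤ σ := by
    by_cases h0 : d = 0
    · obtain ⟨σ, hσ, _⟩ := hcof ⊥ hbot
      exact ⟨σ, hσ, by simp [h0]⟩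
    · obtain ⟨t, ht, htop⟩ := hstd.exists_top h0
      obtain ⟨σ, hσ, hle⟩ := hcof t (hstd.sub t ht)
      exact ⟨σ, hσ, fun p hp => (htop p hp).trans hle⟩
  have h1 : coeff (expo (e σ) d) (phi kk σ (e σ) s) = coeff d s := by
    conv_lhs => rw [s.as_sum]
    rw [map_sum, coeff_sum, Finset.sum_eq_single d]
    · rw [phi_monomial, if_pos hdσ, coeff_monomial, if_pos rfl]
    · intro d' hd' hne
      rw [phi_monomial]
      split_ifs with hd'σ
      · rw [coeff_monomial, if_neg]
        exact fun hE => hne (expo_inj (he σ) _ rfl (hs d' hd') hstd hd'σ hdσ hE)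
      · simp
    · exact fun h => absurd hd h
  rw [hs0 σ hσ, coeff_zero] at h1
  exact (mem_support_iff.1 hd) h1.symm

theorem mk_mem (m : P → P → P) (a : Set P) (f : MvPolynomial P kk) :
    Ideal.Quotient.mk _ f ∈ faceIdeal P kk m a ↔ f ∈ J kk m a := by
  rw [faceIdeal, Ideal.mem_quotient_iff_mem_sup, J]

end FaceAux

open FaceAux

/-- Let `P` be a finite simplicial poset.  The face ideal `I_P^P`
equals the intersection of the prime ideals `I_{(σ)}^P = I_{P_{≤σ}}^P` over the maximal
elements `σ` of `P`; in particular Stanley's face ring `A_P = S/I_P^P` is isomorphic to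
the ring of global sections of the Yuzvinsky sheaf, `S/⋂_σ I_{(σ)}^P`. -/
theorem faceIdeal_eq_inf_of_maximal
    {P : Type*} [Fintype P] [PartialOrder P] [OrderBot P]
    (kk : Type*) [Field kk]
    (hsimp : ∀ p : P, ∃ n : ℕ, Nonempty (Set.Iic p ≃o Finset (Fin n)))
    (m : P → P → P)
    (hm : ∀ p q : P, (∃ z : P, p ≤ z ∧ q ≤ z) →
        IsGreatest {w : P | w ≤ p ∧ w ≤ q} (m p q)) :
    (∀ σ : P, IsMax σ → (faceIdeal P kk m (Set.Iic σ)).IsPrime) ∧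
    (faceIdeal P kk m Set.univ =
      ⨅ σ ∈ {σ : P | IsMax σ}, faceIdeal P kk m (Set.Iic σ)) ∧
    Nonempty
      (((MvPolynomial P kk ⧸ Ideal.span {(X (⊥ : P) : MvPolynomial P kk) - 1}) ⧸
          faceIdeal P kk m Set.univ) ≃+*
        ((MvPolynomial P kk ⧸ Ideal.span {(X (⊥ : P) : MvPolynomial P kk) - 1}) ⧸
          ⨅ σ ∈ {σ : P | IsMax σ}, faceIdeal P kk m (Set.Iic σ))) := by
  choose n hn using hsimp
  have hc : ∀ σ : P, ∃ e : P → Finset (Fin (n σ)), Coord σ e :=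
    fun σ => (hn σ).elim (fun g => exists_coord σ (n σ) g)
  choose e he using hc
  have hIic : ∀ (σ : P) (f : MvPolynomial P kk),
      Ideal.Quotient.mk _ f ∈ faceIdeal P kk m (Set.Iic σ) ↔ phi kk σ (e σ) f = 0 := by
    intro σ f
    rw [mk_mem, mem_J_iff kk e he m hm (Set.Iic σ) (isLowerSet_Iic σ) bot_le {σ} (by simp)
      (fun p hp => ⟨σ, rfl, hp⟩)]
    simp
  have heq : faceIdeal P kk m Set.univ =
      ⨅ σ ∈ {σ : P | IsMax σ}, faceIdeal P kk m (Set.Iic σ) := by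
    ext x
    obtain ⟨f, rfl⟩ := Ideal.Quotient.mk_surjective x
    rw [mk_mem, mem_J_iff kk e he m hm Set.univ isLowerSet_univ trivial {σ | IsMax σ}
      (Set.subset_univ _)]
    · simp only [Submodule.mem_iInf, hIic]
    · intro p _
      obtain ⟨σ, h1, h2⟩ := (Set.toFinite (Set.univ : Set P)).exists_le_maximal (Set.mem_univ p)
      exact ⟨σ, fun y hy => h2.2 trivial hy, h1⟩
  refine ⟨?_, heq, ⟨Ideal.quotEquivOfEq heq⟩⟩
  intro σ _
  refine ⟨?_, ?_⟩
  · rw [Ideal.ne_top_iff_one, ← map_one (Ideal.Quotient.mk _), hIic]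
    simp
  · intro x y hxy
    obtain ⟨f, rfl⟩ := Ideal.Quotient.mk_surjective x
    obtain ⟨g, rfl⟩ := Ideal.Quotient.mk_surjective y
    rw [← map_mul, hIic, map_mul, mul_eq_zero] at hxy
    rwa [hIic, hIic]
end
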